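/- Let R be a commutative ring, let A = R[[q]] be the ring of formal power series in q over R, and let n ≥ 1 and m ≥ 0 be integers. Let b_1, b_2, … ∈ A and set B(T) = 1 + Σ_{j≥1} b_j T^j ∈ A[[T]]. For nonnegative integers k_1, …, k_k with Σ_{j=1}^{k} j·k_j = k, let ρ_{(k_1,…,k_k)} ∈ ℤ[[q]] be the series whose coefficient of q^N is the number of admissible collections {i_r^{(j)}} for (k_1,…,k_k) with n·Σ_{j=1}^{k} j·(i_1^{(j)} + … + i_{k_j}^{(j)}) = N (this number is finite for each N). Define c_k := q^{km} · Σ_{(k_1,…,k_k): Σ j k_j = k} ρ_{(k_1,…,k_k)} · ∏_{j=1}^{k} b_j^{k_j} ∈ A, and set Z(T) := 1 + Σ_{k≥1} c_k T^k ∈ A[[T]]. Then Z(T) = Z(q^n T) · B(q^m T), where Z(q^n T) denotes the series obtained from Z(T) by multiplying the coefficient of T^k by q^{nk}, and B(q^m T) = 1 + Σ_{j≥1} b_j q^{mj} T^j. -/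

import Mathlib

/-- An *admissible collection* for a tuple `(κ 0, …, κ (s-1))` of nonnegative integers:
a family of nonnegative integers `i_r^{(j)}` (`j < s`, `r < κ j`) which is strictly
increasing in `r` for each fixed `j`, and all of whose members (over all pairs `(j, r)`)
are pairwise distinct. -/
def AdmissibleCollection {s : ℕ} (κ : Fin s → ℕ) : Type :=
  {i : (j : Fin s) → Fin (κ j) → ℕ //
    (∀ j, StrictMono (i j)) ∧
    Function.Injective (fun p : Σ j : Fin s, Fin (κ j) => i p.1 p.2)}

/-- `ρ_{(k_1,…,k_k)} ∈ ℤ[[q]]`: its coefficient of `q^N` is the number of admissible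
collections `{i_r^{(j)}}` for `(k_1,…,k_k)` with
`n·Σ_{j=1}^{k} j·(i_1^{(j)} + … + i_{k_j}^{(j)}) = N` (here `κ j = k_{j+1}`). -/
noncomputable def rhoSeries (n : ℕ) {k : ℕ} (κ : Fin k → ℕ) : PowerSeries ℤ :=
  PowerSeries.mk fun N =>
    (Nat.card {i : AdmissibleCollection κ //
      n * ∑ j : Fin k, ((j : ℕ) + 1) * ∑ r, i.1 j r = N} : ℤ)

/-- The (finite) set of tuples `(k_1, …, k_k)` of nonnegative integers with
`Σ_{j=1}^{k} j·k_j = k` (as functions `κ : Fin k → ℕ`, `κ j = k_{j+1}`; note that the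
condition forces `k_j ≤ k` for every `j`). -/
def partitionTuples (k : ℕ) : Finset (Fin k → ℕ) :=
  (Fintype.piFinset fun _ : Fin k => Finset.range (k + 1)).filter
    fun κ => ∑ j : Fin k, ((j : ℕ) + 1) * κ j = k

/-- The coefficient `c_k = q^{km} · Σ_{(k_1,…,k_k) : Σ j·k_j = k} ρ_{(k_1,…,k_k)}
· ∏_{j=1}^{k} b_j^{k_j} ∈ A = R[[q]]`. -/
noncomputable def zetaCoeffStack (R : Type*) [CommRing R] (n m : ℕ)
    (b : ℕ → PowerSeries R) (k : ℕ) : PowerSeries R :=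
  (PowerSeries.X : PowerSeries R) ^ (k * m) *
    ∑ κ ∈ partitionTuples k,
      PowerSeries.map (Int.castRingHom R) (rhoSeries n κ) *
        ∏ j : Fin k, b ((j : ℕ) + 1) ^ κ j

namespace ZetaAux

/-- multiset of nonzero values -/
noncomputable def V {α : Type*} (f : α →₀ ℕ) : Multiset ℕ := f.support.val.map f

noncomputable def W (f : ℕ →₀ ℕ) : ℕ := f.sum fun i a => i * a

lemma W_add (f g : ℕ →₀ ℕ) : W (f + g) = W f + W g :=
  Finsupp.sum_add_index' (by intros; ring) (by intros; ring)

lemma V_embDomain {α β : Type*} (e : α ↪ β) (g : α →₀ ℕ) : V (g.embDomain e) = V g := by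
  unfold V
  rw [Finsupp.support_embDomain, Finset.map_val, Multiset.map_map]
  apply Multiset.map_congr rfl
  intro x _
  simp

lemma V_sum {α : Type*} (f : α →₀ ℕ) : (V f).sum = f.sum fun _ a => a := rfl

lemma zero_notMem_V {α : Type*} (f : α →₀ ℕ) : 0 ∉ V f := by
  simp [V]

def sc : ℕ ↪ ℕ := ⟨Nat.succ, Nat.succ_injective⟩

noncomputable def cons (j : ℕ) (g : ℕ →₀ ℕ) : ℕ →₀ ℕ := Finsupp.single 0 j + g.embDomain sc

lemma cons_zero (j : ℕ) (g : ℕ →₀ ℕ) : cons j g 0 = j := by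
  have : (g.embDomain sc) 0 = 0 := Finsupp.embDomain_of_notMem_range _ _ _ (by simp [sc])
  simp [cons, this]

lemma cons_succ (j : ℕ) (g : ℕ →₀ ℕ) (i : ℕ) : cons j g (i + 1) = g i := by
  have : (g.embDomain sc) (i + 1) = g i := Finsupp.embDomain_apply_self sc g i
  simp [cons, this]

lemma exists_cons (f : ℕ →₀ ℕ) : ∃ j g, f = cons j g := by
  refine ⟨f 0, f.comapDomain Nat.succ Nat.succ_injective.injOn, ?_⟩
  ext i
  cases i with
  | zero => rw [cons_zero]
  | succ i => rw [cons_succ]; rfl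

lemma cons_inj {j j' : ℕ} {g g' : ℕ →₀ ℕ} (h : cons j g = cons j' g') : j = j' ∧ g = g' := by
  constructor
  · rw [← cons_zero j g, h, cons_zero]
  · ext i
    rw [← cons_succ j g, h, cons_succ]

lemma V_cons_zero (g : ℕ →₀ ℕ) : V (cons 0 g) = V g := by
  simp [cons, V_embDomain]

lemma V_cons (j : ℕ) (hj : j ≠ 0) (g : ℕ →₀ ℕ) : V (cons j g) = j ::ₘ V g := by
  have h0 : (g.embDomain sc) 0 = 0 := Finsupp.embDomain_of_notMem_range _ _ _ (by simp [sc])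
  have hs : (cons j g).support = insert 0 (g.embDomain sc).support := by
    ext i
    cases i with
    | zero => simp [cons_zero, hj]
    | succ i =>
      have : (g.embDomain sc) (i + 1) = g i := Finsupp.embDomain_apply_self sc g i
      rw [Finsupp.mem_support_iff, Finset.mem_insert, Finsupp.mem_support_iff, this, cons_succ]
      simp
  rw [← V_embDomain sc g]
  unfold V
  rw [hs, Finset.insert_val_of_notMem (Finsupp.notMem_support_iff.2 h0), Multiset.map_cons, cons_zero]
  congr 1
  apply Multiset.map_congr rfl
  intro x hx
  cases x with
  | zero => exact absurd h0 (Finsupp.mem_support_iff.1 hx)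
  | succ i => simp [cons]

lemma W_cons (j : ℕ) (g : ℕ →₀ ℕ) : W (cons j g) = W g + (V g).sum := by
  rw [cons, W_add, V_sum]
  unfold W
  rw [Finsupp.sum_embDomain, Finsupp.sum_single_index (by simp)]
  simp [sc, Finsupp.sum, add_mul, Finset.sum_add_distrib]

abbrev Sol (n : ℕ) (μ : Multiset ℕ) (s N : ℕ) : Type := {f : ℕ →₀ ℕ // V f = μ ∧ n * (W f + s) = N}

lemma finite_sol (n : ℕ) (hn : 1 ≤ n) (μ : Multiset ℕ) (s N : ℕ) : Finite (Sol n μ s N) := by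
  have key : ∀ f : Sol n μ s N, ∀ i, f.1 i ≠ 0 → i ≤ N ∧ f.1 i ≤ μ.sum := by
    rintro ⟨f, h1, h2⟩ i hi
    dsimp only at hi ⊢
    have hm : i ∈ f.support := by simpa using hi
    constructor
    · have : i * f i ≤ W f := Finset.single_le_sum (f := fun i => i * f i) (by simp) hm
      have h3 : i ≤ i * f i := Nat.le_mul_of_pos_right _ (Nat.pos_of_ne_zero hi)
      have h4 : W f + s ≤ n * (W f + s) := Nat.le_mul_of_pos_left _ hn
      omega
    · rw [← h1]
      exact Multiset.single_le_sum (by simp) _ (Multiset.mem_map_of_mem _ hm)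
  let F : Sol n μ s N → (Fin (N + 1) → Fin (μ.sum + 1)) := fun f i =>
    ⟨f.1 i, by
      by_cases h : f.1 i = 0
      · omega
      · have := (key f i h).2; omega⟩
  apply Finite.of_injective F
  intro f g h
  apply Subtype.ext
  ext i
  by_cases hi : i ≤ N
  · have := congrFun h ⟨i, by omega⟩
    simpa [F] using this
  · have h1 : f.1 i = 0 := by
      by_contra h'; exact hi (key f i h').1
    have h2 : g.1 i = 0 := by
      by_contra h'; exact hi (key g i h').1
    rw [h1, h2]

noncomputable def splitMap (n : ℕ) (μ : Multiset ℕ) (h0 : 0 ∉ μ) (N : ℕ) :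
    Sol n μ μ.sum N ⊕ (Σ j : μ.toFinset, Sol n (μ.erase j.1) (μ.erase j.1).sum N) → Sol n μ 0 N
  | Sum.inl g => ⟨cons 0 g.1, by rw [V_cons_zero, g.2.1], by
      rw [W_cons, g.2.1]; exact g.2.2⟩
  | Sum.inr ⟨j, g⟩ =>
    ⟨cons j.1 g.1, by
      have hj : j.1 ∈ μ := Multiset.mem_toFinset.1 j.2
      have hj0 : j.1 ≠ 0 := fun h => h0 (h ▸ hj)
      rw [V_cons _ hj0, g.2.1, Multiset.cons_erase hj], by
      rw [W_cons, g.2.1]; exact g.2.2⟩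

lemma splitMap_bij (n : ℕ) (μ : Multiset ℕ) (h0 : 0 ∉ μ) (N : ℕ) :
    Function.Bijective (splitMap n μ h0 N) := by
  constructor
  · rintro (g | ⟨⟨j, hj⟩, g⟩) (g' | ⟨⟨j', hj'⟩, g'⟩) h
    · have := cons_inj (congrArg Subtype.val h)
      rw [Subtype.ext this.2]
    · have := cons_inj (congrArg Subtype.val h)
      exact absurd (Multiset.mem_toFinset.1 hj') (by rw [← show 0 = j' from this.1]; exact h0)
    · have := cons_inj (congrArg Subtype.val h)
      exact absurd (Multiset.mem_toFinset.1 hj) (by rw [show j = 0 from this.1]; exact h0)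
    · have := cons_inj (congrArg Subtype.val h)
      obtain ⟨h1, h2⟩ := this
      dsimp only at h1
      subst h1
      rw [Subtype.ext h2]
  · rintro ⟨f, h1, h2⟩
    obtain ⟨j, g, rfl⟩ := exists_cons f
    have h3 : n * (W g + (V g).sum) = N := by rw [← W_cons j]; exact h2
    by_cases hj : j = 0
    · subst hj
      rw [V_cons_zero] at h1
      exact ⟨Sum.inl ⟨g, h1, by rw [← h1]; exact h3⟩, rfl⟩
    · rw [V_cons _ hj] at h1
      have hjm : j ∈ μ := by rw [← h1]; simp
      have he : V g = μ.erase j := by rw [← h1]; simp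
      exact ⟨Sum.inr ⟨⟨j, Multiset.mem_toFinset.2 hjm⟩, ⟨g, he, by
        dsimp only; rw [← he]; exact h3⟩⟩, rfl⟩

noncomputable def rho (n : ℕ) (μ : Multiset ℕ) : PowerSeries ℤ :=
  PowerSeries.mk fun N => (Nat.card (Sol n μ 0 N) : ℤ)

lemma coeff_shift (n : ℕ) (μ : Multiset ℕ) (s N : ℕ) :
    PowerSeries.coeff N ((PowerSeries.X : PowerSeries ℤ) ^ (n * s) * rho n μ) =
      (Nat.card (Sol n μ s N) : ℤ) := by
  rw [PowerSeries.coeff_X_pow_mul']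
  split_ifs with h
  · rw [rho, PowerSeries.coeff_mk]
    congr 1
    apply Nat.card_congr
    apply Equiv.subtypeEquivRight
    intro f
    rw [mul_add, mul_add]
    apply and_congr_right
    intro _
    omega
  · have : IsEmpty (Sol n μ s N) := ⟨fun f => h (by
      rw [← f.2.2, mul_add]; omega)⟩
    simp

lemma rho_rec (n : ℕ) (hn : 1 ≤ n) (μ : Multiset ℕ) (h0 : 0 ∉ μ) :
    rho n μ = PowerSeries.X ^ (n * μ.sum) * rho n μ +
      ∑ j ∈ μ.toFinset, PowerSeries.X ^ (n * (μ.erase j).sum) * rho n (μ.erase j) := by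
  ext N
  have hf := finite_sol n hn
  rw [map_add, map_sum, coeff_shift n]
  simp_rw [coeff_shift n]
  rw [rho, PowerSeries.coeff_mk, ← Nat.card_congr (Equiv.ofBijective _ (splitMap_bij n μ h0 N)),
    Nat.card_sum, Nat.card_sigma, Finset.univ_eq_attach,
    Finset.sum_attach μ.toFinset (fun j => Nat.card (Sol n (μ.erase j) (μ.erase j).sum N))]
  push_cast
  rfl

noncomputable def P (k : ℕ) : Finset (Multiset ℕ) :=
  (Finset.univ : Finset (Nat.Partition k)).image Nat.Partition.parts

lemma mem_P {k : ℕ} {μ : Multiset ℕ} : μ ∈ P k ↔ μ.sum = k ∧ 0 ∉ μ := by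
  unfold P
  rw [Finset.mem_image]
  constructor
  · rintro ⟨p, _, rfl⟩
    exact ⟨p.parts_sum, fun h => absurd (p.parts_pos h) (by simp)⟩
  · rintro ⟨h1, h2⟩
    exact ⟨⟨μ, fun {i} hi => Nat.pos_of_ne_zero (fun h => h2 (h ▸ hi)), h1⟩, by simp, rfl⟩

section
variable {R : Type*} [CommRing R]

noncomputable def S (n : ℕ) (b : ℕ → PowerSeries R) (k : ℕ) : PowerSeries R :=
  ∑ μ ∈ P k, PowerSeries.map (Int.castRingHom R) (rho n μ) * (μ.map b).prod

lemma sum_P (k : ℕ) {M : Type*} [AddCommMonoid M] (F : ℕ → Multiset ℕ → M) :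
    ∑ μ ∈ P k, ∑ j ∈ μ.toFinset, F j (μ.erase j) =
      ∑ p ∈ (Finset.HasAntidiagonal.antidiagonal k).filter (fun p => p.2 ≠ 0), ∑ ν ∈ P p.1, F p.2 ν := by
  rw [Finset.sum_sigma', Finset.sum_sigma']
  refine Finset.sum_bij' (fun x _ => ⟨((x.1.erase x.2).sum, x.2), x.1.erase x.2⟩)
    (fun y _ => ⟨y.1.2 ::ₘ y.2, y.1.2⟩) ?_ ?_ ?_ ?_ ?_
  · rintro ⟨μ, j⟩ h
    simp only [Finset.mem_sigma, mem_P, Multiset.mem_toFinset] at h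
    obtain ⟨⟨h1, h2⟩, h3⟩ := h
    simp only [Finset.mem_sigma, mem_P, Finset.mem_filter, Finset.HasAntidiagonal.mem_antidiagonal]
    refine ⟨⟨?_, fun h => h2 (h ▸ h3)⟩, trivial, fun h => h2 (Multiset.mem_of_mem_erase h)⟩
    rw [← h1, add_comm, Multiset.sum_erase h3]
  · rintro ⟨⟨a, j⟩, ν⟩ h
    simp only [Finset.mem_sigma, mem_P, Finset.mem_filter, Finset.HasAntidiagonal.mem_antidiagonal] at h
    obtain ⟨⟨h1, h2⟩, h3, h4⟩ := h
    simp only [Finset.mem_sigma, mem_P, Multiset.mem_toFinset]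
    refine ⟨⟨by simp; omega, by simp [h4]; omega⟩, by simp⟩
  · rintro ⟨μ, j⟩ h
    simp only [Finset.mem_sigma, mem_P, Multiset.mem_toFinset] at h
    simp [Multiset.cons_erase h.2]
  · rintro ⟨⟨a, j⟩, ν⟩ h
    simp only [Finset.mem_sigma, mem_P] at h
    simp [h.2.1]
  · rintro ⟨μ, j⟩ h
    rfl

lemma S_rec (n : ℕ) (hn : 1 ≤ n) (b : ℕ → PowerSeries R) (k : ℕ) :
    S n b k = ∑ p ∈ Finset.HasAntidiagonal.antidiagonal k,
      (PowerSeries.X ^ (n * p.1) * S n b p.1) * (if p.2 = 0 then 1 else b p.2) := by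
  let F : ℕ → Multiset ℕ → PowerSeries R := fun j ν =>
    PowerSeries.X ^ (n * ν.sum) * (PowerSeries.map (Int.castRingHom R) (rho n ν) *
      (ν.map b).prod) * b j
  have h1 : S n b k = PowerSeries.X ^ (n * k) * S n b k + ∑ μ ∈ P k, ∑ j ∈ μ.toFinset,
      F j (μ.erase j) := by
    conv_lhs => rw [S]
    rw [S, Finset.mul_sum, ← Finset.sum_add_distrib]
    apply Finset.sum_congr rfl
    intro μ hμ
    rw [mem_P] at hμ
    conv_lhs => rw [rho_rec n hn μ hμ.2]
    rw [map_add, map_sum, add_mul, Finset.sum_mul, hμ.1]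
    congr 1
    · simp [mul_assoc]
    · apply Finset.sum_congr rfl
      intro j hj
      rw [← Multiset.prod_map_erase (Multiset.mem_toFinset.1 hj)]
      simp only [map_mul, map_pow, PowerSeries.map_X, F]
      ring
  rw [h1, sum_P k F, ← Finset.sum_filter_add_sum_filter_not (Finset.HasAntidiagonal.antidiagonal k) (fun p => p.2 = 0)]
  congr 1
  · rw [Finset.sum_eq_single (k, 0)]
    · simp
    · rintro ⟨a, j⟩ h hne
      simp only [Finset.mem_filter, Finset.HasAntidiagonal.mem_antidiagonal] at h
      exfalso; apply hne; ext <;> simp <;> omega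
    · simp
  · apply Finset.sum_congr rfl
    rintro ⟨a, j⟩ h
    simp only [Finset.mem_filter, Finset.HasAntidiagonal.mem_antidiagonal] at h
    simp only [h.2, if_false]
    rw [S, Finset.mul_sum, Finset.sum_mul]
    apply Finset.sum_congr rfl
    intro ν hν
    rw [mem_P] at hν
    simp only [F]
    rw [hν.1]

/-- multiset of a tuple -/
def mu {k : ℕ} (κ : Fin k → ℕ) : Multiset ℕ := ∑ j : Fin k, Multiset.replicate (κ j) ((j : ℕ) + 1)

lemma mu_sum {k : ℕ} (κ : Fin k → ℕ) : (mu κ).sum = ∑ j : Fin k, ((j : ℕ) + 1) * κ j := by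
  rw [mu, Multiset.sum_sum]
  simp [mul_comm]

lemma mem_mu {k : ℕ} (κ : Fin k → ℕ) (x : ℕ) (h : x ∈ mu κ) : ∃ j : Fin k, x = j + 1 := by
  rw [mu, Multiset.mem_sum] at h
  obtain ⟨j, _, hj⟩ := h
  exact ⟨j, Multiset.eq_of_mem_replicate hj⟩

lemma mu_count {k : ℕ} (κ : Fin k → ℕ) (j : Fin k) : (mu κ).count ((j : ℕ) + 1) = κ j := by
  rw [mu, Multiset.count_sum']
  simp [Multiset.count_replicate, Fin.val_inj]

lemma mu_prod {k : ℕ} (κ : Fin k → ℕ) (b : ℕ → PowerSeries R) :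
    ((mu κ).map b).prod = ∏ j : Fin k, b ((j : ℕ) + 1) ^ κ j := by
  rw [mu, ← Multiset.coe_mapAddMonoidHom, map_sum, Multiset.prod_sum]
  simp

noncomputable def toF {k : ℕ} (κ : Fin k → ℕ) (i : AdmissibleCollection κ) : ℕ →₀ ℕ :=
  (Finsupp.equivFunOnFinite.symm (fun p : Σ j : Fin k, Fin (κ j) => (p.1 : ℕ) + 1)).embDomain
    ⟨fun p => i.1 p.1 p.2, i.2.2⟩

lemma V_toF {k : ℕ} (κ : Fin k → ℕ) (i : AdmissibleCollection κ) : V (toF κ i) = mu κ := by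
  rw [toF, V_embDomain]
  have : (Finsupp.equivFunOnFinite.symm
      (fun p : Σ j : Fin k, Fin (κ j) => (p.1 : ℕ) + 1)).support = Finset.univ := by
    ext; simp
  rw [V, this]
  change Multiset.map (fun p : Σ j : Fin k, Fin (κ j) => (p.1 : ℕ) + 1) _ = _
  rw [← Multiset.sum_map_singleton (Multiset.map _ _), Multiset.map_map]
  change ∑ p : (Σ j : Fin k, Fin (κ j)), ({(p.1 : ℕ) + 1} : Multiset ℕ) = _
  rw [Fintype.sum_sigma, mu]
  simp [Multiset.nsmul_singleton]

lemma W_toF {k : ℕ} (κ : Fin k → ℕ) (i : AdmissibleCollection κ) :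
    W (toF κ i) = ∑ j : Fin k, ((j : ℕ) + 1) * ∑ r, i.1 j r := by
  rw [toF, W, Finsupp.sum_embDomain, Finsupp.sum_fintype _ _ (by simp), Fintype.sum_sigma]
  apply Finset.sum_congr rfl
  intro j _
  rw [Finset.mul_sum]
  apply Finset.sum_congr rfl
  intro r _
  simp [mul_comm]

lemma toF_eq_iff {k : ℕ} (κ : Fin k → ℕ) (i : AdmissibleCollection κ) (j : Fin k) (x : ℕ) :
    toF κ i x = j + 1 ↔ x ∈ Set.range (i.1 j) := by
  constructor
  · intro h
    by_cases hx : x ∈ Set.range (fun p : Σ j : Fin k, Fin (κ j) => i.1 p.1 p.2)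
    · obtain ⟨p, rfl⟩ := hx
      have := Finsupp.embDomain_apply_self (⟨fun p => i.1 p.1 p.2, i.2.2⟩ : _ ↪ ℕ)
        (Finsupp.equivFunOnFinite.symm (fun p : Σ j : Fin k, Fin (κ j) => (p.1 : ℕ) + 1)) p
      have h2 := this.symm.trans h
      simp [Fin.val_inj] at h2
      subst h2
      exact ⟨p.2, rfl⟩
    · have := Finsupp.embDomain_of_notMem_range (⟨fun p => i.1 p.1 p.2, i.2.2⟩ : _ ↪ ℕ)
        (Finsupp.equivFunOnFinite.symm (fun p : Σ j : Fin k, Fin (κ j) => (p.1 : ℕ) + 1)) x hx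
      have h2 := this.symm.trans h
      omega
  · rintro ⟨r, rfl⟩
    exact Finsupp.embDomain_apply_self (⟨fun p => i.1 p.1 p.2, i.2.2⟩ : _ ↪ ℕ)
        (Finsupp.equivFunOnFinite.symm (fun p : Σ j : Fin k, Fin (κ j) => (p.1 : ℕ) + 1)) ⟨j, r⟩

lemma toF_injective {k : ℕ} (κ : Fin k → ℕ) : Function.Injective (toF κ) := by
  intro i i' h
  apply Subtype.ext
  funext j
  apply ((i.2.1 j).range_inj (i'.2.1 j)).1
  ext x
  rw [← toF_eq_iff, ← toF_eq_iff, h]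

lemma toF_surj {k : ℕ} (κ : Fin k → ℕ) (f : ℕ →₀ ℕ) (hf : V f = mu κ) : ∃ i, toF κ i = f := by
  have hc : ∀ j : Fin k, (f.support.filter (fun x => f x = j + 1)).card = κ j := by
    intro j
    rw [← mu_count κ j, ← hf, V, Multiset.count_map]
    simp only [eq_comm]
    rfl
  let i : (j : Fin k) → Fin (κ j) → ℕ := fun j => Finset.orderEmbOfFin _ (hc j)
  have hi : ∀ j x, x ∈ Set.range (i j) ↔ f x = j + 1 := by
    intro j x
    simp only [i, Finset.range_orderEmbOfFin]
    simp
    omega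
  let c : AdmissibleCollection κ := ⟨i, fun j => (Finset.orderEmbOfFin _ (hc j)).strictMono, by
    rintro ⟨j, r⟩ ⟨j', r'⟩ h
    dsimp only at h
    have h1 := (hi j (i j r)).1 ⟨r, rfl⟩
    have h2 := (hi j' (i j r)).1 ⟨r', h.symm⟩
    have : j = j' := by ext; omega
    subst this
    have := (Finset.orderEmbOfFin _ (hc j)).injective h
    rw [this]⟩
  refine ⟨c, ?_⟩
  have key : ∀ j : Fin k, ∀ x, toF κ c x = j + 1 ↔ f x = j + 1 := fun j x => by
    rw [toF_eq_iff]; exact hi j x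
  have hval : ∀ g : ℕ →₀ ℕ, V g = mu κ → ∀ x, g x ≠ 0 → ∃ j : Fin k, g x = j + 1 := by
    intro g hg x hx
    apply mem_mu κ
    rw [← hg]
    exact Multiset.mem_map_of_mem _ (by simpa using hx)
  ext x
  by_cases h : f x = 0
  · by_contra h'
    rw [h] at h'
    obtain ⟨j, hj⟩ := hval _ (V_toF κ c) x h'
    have := (key j x).1 hj
    omega
  · obtain ⟨j, hj⟩ := hval f hf x h
    rw [hj, key, hj]

lemma rhoSeries_eq (n : ℕ) {k : ℕ} (κ : Fin k → ℕ) : rhoSeries n κ = rho n (mu κ) := by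
  ext N
  rw [rhoSeries, rho, PowerSeries.coeff_mk, PowerSeries.coeff_mk]
  congr 1
  apply Nat.card_congr
  refine Equiv.ofBijective (fun i => ⟨toF κ i.1, V_toF κ i.1, ?_⟩) ⟨?_, ?_⟩
  · rw [W_toF]; exact i.2
  · intro i i' h
    exact Subtype.ext (toF_injective κ (congrArg Subtype.val h))
  · rintro ⟨f, h1, h2⟩
    obtain ⟨i, rfl⟩ := toF_surj κ f h1
    exact ⟨⟨i, by rw [← W_toF]; exact h2⟩, rfl⟩

lemma mu_counts {k : ℕ} {μ : Multiset ℕ} (hμ : μ ∈ P k) :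
    mu (fun j : Fin k => μ.count ((j : ℕ) + 1)) = μ := by
  rw [mem_P] at hμ
  ext x
  by_cases hx : ∃ j : Fin k, x = j + 1
  · obtain ⟨j, rfl⟩ := hx
    rw [mu_count]
  · rw [Multiset.count_eq_zero_of_notMem (fun h => hx (mem_mu _ _ h)),
      Multiset.count_eq_zero_of_notMem]
    intro h
    apply hx
    have h1 : x ≤ μ.sum := Multiset.single_le_sum (by simp) _ h
    have h2 : x ≠ 0 := fun h' => hμ.2 (h' ▸ h)
    exact ⟨⟨x - 1, by omega⟩, by simp; omega⟩

lemma S_zero (n : ℕ) (b : ℕ → PowerSeries R) : S n b 0 = 1 := by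
  have hP : P 0 = {0} := by
    ext μ
    rw [mem_P, Finset.mem_singleton]
    constructor
    · rintro ⟨h1, h2⟩
      apply Multiset.eq_zero_of_forall_notMem
      intro x hx
      have h3 : x ≤ μ.sum := Multiset.single_le_sum (by simp) _ hx
      have h4 : x = 0 := by omega
      exact h2 (h4 ▸ hx)
    · rintro rfl
      simp
  have hV : ∀ f : ℕ →₀ ℕ, V f = 0 ↔ f = 0 := by
    intro f
    simp [V]
  have hr : rho n 0 = 1 := by
    ext N
    rw [rho, PowerSeries.coeff_mk, PowerSeries.coeff_one]
    split_ifs with h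
    · subst h
      have : Nat.card (Sol n 0 0 0) = 1 := by
        rw [Nat.card_eq_one_iff_unique]
        refine ⟨⟨fun f g => Subtype.ext ?_⟩, ⟨⟨0, by simp [V], by simp [W]⟩⟩⟩
        rw [(hV _).1 f.2.1, (hV _).1 g.2.1]
      rw [this]; rfl
    · have : IsEmpty (Sol n 0 0 N) := ⟨fun f => h (by
        have h2 := f.2.2
        rw [(hV _).1 f.2.1] at h2
        simp [W] at h2
        exact h2.symm)⟩
      simp
  simp [S, hP, hr]

lemma zeta_eq (n m : ℕ) (b : ℕ → PowerSeries R) (k : ℕ) :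
    zetaCoeffStack R n m b k = PowerSeries.X ^ (k * m) * S n b k := by
  rw [zetaCoeffStack, S]
  congr 1
  refine Finset.sum_bij' (fun κ _ => mu κ) (fun μ _ j => μ.count ((j : ℕ) + 1)) ?_ ?_ ?_ ?_ ?_
  · intro κ h
    rw [partitionTuples, Finset.mem_filter] at h
    rw [mem_P, mu_sum]
    refine ⟨h.2, fun h0 => ?_⟩
    obtain ⟨j, hj⟩ := mem_mu κ _ h0
    omega
  · intro μ h
    have hs := mu_sum (fun j : Fin k => μ.count ((j : ℕ) + 1))
    rw [mu_counts h, (mem_P.1 h).1] at hs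
    rw [partitionTuples, Finset.mem_filter, Fintype.mem_piFinset]
    refine ⟨fun j => ?_, hs.symm⟩
    rw [Finset.mem_range]
    have h1 := Finset.single_le_sum (f := fun j : Fin k => ((j : ℕ) + 1) * μ.count ((j : ℕ) + 1))
      (by simp) (Finset.mem_univ j)
    have h2 : μ.count ((j : ℕ) + 1) ≤ ((j : ℕ) + 1) * μ.count ((j : ℕ) + 1) :=
      Nat.le_mul_of_pos_left _ (by omega)
    omega
  · intro κ _
    funext j
    exact mu_count κ j
  · intro μ h
    exact mu_counts h
  · intro κ _
    rw [rhoSeries_eq, mu_prod]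

end

end ZetaAux

/-- Let `R` be a commutative ring, `A = R[[q]]`, `n ≥ 1`, `m ≥ 0`,
`b_1, b_2, … ∈ A` and `B(T) = 1 + Σ_{j≥1} b_j T^j ∈ A[[T]]`. With
`c_k := q^{km} Σ_{(k_1,…,k_k) : Σ j k_j = k} ρ_{(k_1,…,k_k)} ∏_j b_j^{k_j}` and
`Z(T) := 1 + Σ_{k≥1} c_k T^k`, one has `Z(T) = Z(q^n T) · B(q^m T)`, where `Z(q^n T)`
is obtained from `Z(T)` by multiplying the coefficient of `T^k` by `q^{nk}`, and
`B(q^m T) = 1 + Σ_{j≥1} b_j q^{mj} T^j`. -/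
theorem zeta_coefficient_formula_functional_equation (R : Type*) [CommRing R]
    (n m : ℕ) (hn : 1 ≤ n) (b : ℕ → PowerSeries R) :
    (PowerSeries.mk fun k => if k = 0 then 1 else zetaCoeffStack R n m b k :
        PowerSeries (PowerSeries R)) =
      PowerSeries.rescale ((PowerSeries.X : PowerSeries R) ^ n)
          (PowerSeries.mk fun k => if k = 0 then 1 else zetaCoeffStack R n m b k) *
        PowerSeries.rescale ((PowerSeries.X : PowerSeries R) ^ m)
          (PowerSeries.mk fun j => if j = 0 then 1 else b j) := by
  have h0 : zetaCoeffStack R n m b 0 = 1 := by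
    rw [ZetaAux.zeta_eq, ZetaAux.S_zero]; simp
  have hz : ∀ k, (if k = 0 then 1 else zetaCoeffStack R n m b k) =
      PowerSeries.X ^ (k * m) * ZetaAux.S n b k := by
    intro k
    rw [← ZetaAux.zeta_eq]
    split_ifs with h
    · rw [h, h0]
    · rfl
  simp_rw [hz]
  ext1 k
  rw [PowerSeries.coeff_mk, PowerSeries.coeff_mul, ZetaAux.S_rec n hn, Finset.mul_sum]
  apply Finset.sum_congr rfl
  rintro ⟨a, j⟩ h
  rw [Finset.HasAntidiagonal.mem_antidiagonal] at h
  subst h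
  simp only [PowerSeries.coeff_rescale, PowerSeries.coeff_mk]
  rw [← pow_mul, ← pow_mul, add_mul, pow_add, mul_comm m j]
  ring
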